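/- For all positive integers a and d, there exist z₁, z₂ ∈ ℤ¹⁰ such that Σᵢ (z₁)ᵢ² = a, Σᵢ (z₂)ᵢ² = d, Σᵢ (z₁)ᵢ(z₂)ᵢ = 0, the subgroup ℤz₁ + ℤz₂ is primitive in ℤ¹⁰, i.e. (ℚz₁ + ℚz₂) ∩ ℤ¹⁰ = ℤz₁ + ℤz₂, and there exists a ℤ-linear automorphism σ of ℤ¹⁰ preserving the standard dot product with σ(z₁) = −z₁ and σ(z₂) = z₂. -/

import Mathlib

/-- The standard dot product on `ℤ¹⁰`. -/
def dot10 (x y : Fin 10 → ℤ) : ℤ := ∑ i, x i * y i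

/-- For all positive integers `a`, `d`, there exist orthogonal vectors `z₁`, `z₂` in
`ℤ¹⁰` of square `a`, `d`, spanning a primitive subgroup, such that the reflection
along `z₁` extends to an isometry of `ℤ¹⁰`. -/
theorem stmt3 (a d : ℤ) (ha : 0 < a) (hd : 0 < d) :
    ∃ z₁ z₂ : Fin 10 → ℤ,
      dot10 z₁ z₁ = a ∧ dot10 z₂ z₂ = d ∧ dot10 z₁ z₂ = 0 ∧
      (∀ x : Fin 10 → ℤ,
        (∃ p q : ℚ, (fun i => (x i : ℚ))
          = p • (fun i => (z₁ i : ℚ)) + q • (fun i => (z₂ i : ℚ))) →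
        ∃ m n : ℤ, x = m • z₁ + n • z₂) ∧
      ∃ σ : (Fin 10 → ℤ) ≃ₗ[ℤ] (Fin 10 → ℤ),
        (∀ x y, dot10 (σ x) (σ y) = dot10 x y) ∧ σ z₁ = -z₁ ∧ σ z₂ = z₂ := by
  obtain ⟨A, hA⟩ := Int.eq_ofNat_of_zero_le (show 0 ≤ a - 1 by omega)
  obtain ⟨D, hD⟩ := Int.eq_ofNat_of_zero_le (show 0 ≤ d - 1 by omega)
  obtain ⟨a1, a2, a3, a4, h1⟩ := Nat.sum_four_squares A
  obtain ⟨d1, d2, d3, d4, h2⟩ := Nat.sum_four_squares D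
  have h1' : (a1:ℤ)^2 + a2^2 + a3^2 + a4^2 = A := by exact_mod_cast h1
  have h2' : (d1:ℤ)^2 + d2^2 + d3^2 + d4^2 = D := by exact_mod_cast h2
  let s : Fin 10 → ℤ := ![-1, -1, -1, -1, -1, 1, 1, 1, 1, 1]
  have hs : ∀ i, s i * s i = 1 := by
    intro i
    fin_cases i <;> simp [s]
  refine ⟨![1, a1, a2, a3, a4, 0, 0, 0, 0, 0], ![0, 0, 0, 0, 0, 1, d1, d2, d3, d4],
    ?_, ?_, ?_, ?_, ?_⟩
  · simp [dot10, Fin.sum_univ_succ]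
    linarith
  · simp [dot10, Fin.sum_univ_succ]
    linarith
  · simp [dot10, Fin.sum_univ_succ]
  · rintro x ⟨p, q, h⟩
    have hp : (x 0 : ℚ) = p := by simpa using congrFun h 0
    have hq : (x 5 : ℚ) = q := by simpa using congrFun h 5
    refine ⟨x 0, x 5, ?_⟩
    funext i
    have hi := congrFun h i
    rw [← hp, ← hq] at hi
    simp only [Pi.add_apply, Pi.smul_apply, smul_eq_mul] at hi ⊢
    exact_mod_cast hi
  · refine ⟨{ toFun := fun x i => s i * x i
              invFun := fun x i => s i * x i
              map_add' := ?_
              map_smul' := ?_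
              left_inv := ?_
              right_inv := ?_ }, ?_, ?_, ?_⟩
    · intro x y
      funext i
      simp [mul_add]
    · intro c x
      funext i
      simp [mul_left_comm]
    · intro x
      funext i
      simp [← mul_assoc, hs]
    · intro x
      funext i
      simp [← mul_assoc, hs]
    · intro x y
      refine Finset.sum_congr rfl fun i _ => ?_
      change (s i * x i) * (s i * y i) = x i * y i
      linear_combination (x i * y i) * hs i
    · funext i
      fin_cases i <;> simp [s]
    · funext i
      fin_cases i <;> simp [s]
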